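/- Let F be a finite closed antipodal-free cover of S^n with two linear orders ≤₁, ≤₂. Then there exists u ∈ S^n such that h₊₊ · h₊₋ ≥ (n+1)/2, where h₊₊ is the maximum length of an alternating pattern witnessed by u or -u that is increasing in both ≤₁ and ≤₂, and h₊₋ is the maximum length of an alternating pattern witnessed by u or -u that is increasing in ≤₁ and decreasing in ≤₂. -/

import Mathlib

open Pointwise

/-- The maximal length of an alternating pattern witnessed by `u` or `-u` that is
(strictly) increasing with respect to both relations `lt₁` and `lt₂`. -/
noncomputable def maxAltPattern {E : Type*} [SMul ℝ E] {ι : Type*}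
    (lt₁ lt₂ : ι → ι → Prop) (F : ι → Set E) (u : E) : ℕ :=
  sSup {k : ℕ | ∃ ε : ℝ, (ε = 1 ∨ ε = -1) ∧ ∃ g : Fin k → ι,
    (∀ i j : Fin k, i < j → lt₁ (g i) (g j) ∧ lt₂ (g i) (g j)) ∧
    ∀ i : Fin k, (ε * (-1 : ℝ) ^ (i : ℕ)) • u ∈ F (g i)}

namespace KyFan

section Cochains

variable {X : Type*}

/-- The simplicial coboundary on mod 2 cochains, a `k`-simplex being a list of `k + 1` points. -/
def coboundary : (List X → ZMod 2) → List X → ZMod 2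
  | _, [] => 0
  | φ, x :: l => φ l + coboundary (fun m => φ (x :: m)) l

/-- The pullback of a mod 2 cochain to the prism spanned by two maps `f` and `g`. -/
def prism (f g : X → X) : (List X → ZMod 2) → List X → ZMod 2
  | _, [] => 0
  | φ, x :: l => φ (f x :: g x :: l.map g) + prism f g (fun m => φ (f x :: m)) l

theorem coboundary_add (φ ψ : List X → ZMod 2) (l : List X) :
    coboundary (fun m => φ m + ψ m) l = coboundary φ l + coboundary ψ l := by
  induction l generalizing φ ψ with
  | nil => simp [coboundary]
  | cons x l ih => simp only [coboundary, ih]; ring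

theorem coboundary_const_mul (a : ZMod 2) (φ : List X → ZMod 2) (l : List X) :
    coboundary (fun m => a * φ m) l = a * coboundary φ l := by
  induction l generalizing φ with
  | nil => simp [coboundary]
  | cons x l ih => simp only [coboundary, ih]; ring

theorem coboundary_comp_map (f : X → X) (φ : List X → ZMod 2) (l : List X) :
    coboundary (fun m => φ (m.map f)) l = coboundary φ (l.map f) := by
  induction l generalizing φ with
  | nil => simp [coboundary]
  | cons x l ih => simp only [coboundary, List.map_cons, ih (fun m => φ (f x :: m))]

theorem coboundary_coboundary (φ : List X → ZMod 2) (l : List X) :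
    coboundary (coboundary φ) l = 0 := by
  induction l generalizing φ with
  | nil => rfl
  | cons x l ih =>
    simp only [coboundary, coboundary_add, ih]
    rw [add_zero, CharTwo.add_self_eq_zero]

theorem prism_add (f g : X → X) (φ ψ : List X → ZMod 2) (l : List X) :
    prism f g (fun m => φ m + ψ m) l = prism f g φ l + prism f g ψ l := by
  induction l generalizing φ ψ with
  | nil => simp [prism]
  | cons x l ih => simp only [prism, ih]; ring

theorem prism_coboundary (f g : X → X) (φ : List X → ZMod 2) (l : List X) :
    prism f g (coboundary φ) l + coboundary (prism f g φ) l = φ (l.map g) + φ (l.map f) := by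
  induction l generalizing φ with
  | nil => simp [prism, coboundary, CharTwo.add_self_eq_zero]
  | cons x l ih =>
    simp only [prism, coboundary, List.map_cons, coboundary_add, prism_add,
      coboundary_comp_map g (fun m => φ (f x :: g x :: m))]
    have h := ih (fun m => φ (f x :: m))
    linear_combination h + CharTwo.add_self_eq_zero (prism f g φ l)
      + CharTwo.add_self_eq_zero (coboundary (fun m => φ (f x :: g x :: m)) (l.map g))
      + CharTwo.add_self_eq_zero (φ (f x :: l.map g))

theorem prism_eq_zero (f g : X → X) (φ : List X → ZMod 2) (l : List X)
    (h : ∀ m : List X, (∀ y ∈ m, ∃ x ∈ l, y = f x ∨ y = g x) → φ m = 0) :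
    prism f g φ l = 0 := by
  induction l generalizing φ with
  | nil => rfl
  | cons x l ih =>
    rw [prism, ih, h, add_zero]
    · intro y hy
      simp only [List.mem_cons, List.mem_map] at hy
      grind
    · intro m hm
      refine h _ fun y hy => ?_
      grind

/-- `prism` as an additive endomorphism of the group of cochains. -/
def prismHom (f g : X → X) : (List X → ZMod 2) →+ (List X → ZMod 2) where
  toFun := prism f g
  map_zero' := by
    funext l
    exact prism_eq_zero f g 0 l fun _ _ => rfl
  map_add' φ ψ := by
    funext l
    exact prism_add f g φ ψ l

/-- The cup product of the coboundaries of a list of `0`-cochains. -/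
def cup : List (X → ZMod 2) → List X → ZMod 2
  | [], [_] => 1
  | s :: ss, x :: y :: l => (s x + s y) * cup ss (y :: l)
  | _, _ => 0

/-- The cup product of a `0`-cochain `s` with `cup ss`. -/
def cupLeft (s : X → ZMod 2) (ss : List (X → ZMod 2)) : List X → ZMod 2
  | [] => 0
  | x :: l => s x * cup ss (x :: l)

theorem coboundary_cupLeft_of_cocycle (s : X → ZMod 2) (ss : List (X → ZMod 2))
    (hss : ∀ l, coboundary (cup ss) l = 0) (l : List X) :
    coboundary (cupLeft s ss) l = cup (s :: ss) l := by
  match l with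
  | [] => simp [coboundary, cup]
  | [x] => simp [coboundary, cup, cupLeft]
  | x :: y :: l =>
    have h := hss (x :: y :: l)
    rw [coboundary] at h ⊢
    simp only [cupLeft, coboundary_const_mul, cup]
    linear_combination s x * h - s x * CharTwo.add_self_eq_zero (cup ss (y :: l))

theorem coboundary_cup (ss : List (X → ZMod 2)) (l : List X) : coboundary (cup ss) l = 0 := by
  induction ss generalizing l with
  | nil =>
    match l with
    | [] => rfl
    | [x] => simp [coboundary, cup]
    | [x, y] => simp [coboundary, cup, CharTwo.add_self_eq_zero]
    | x :: y :: z :: l =>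
      have h : ∀ l : List X, coboundary (fun _ => (0 : ZMod 2)) l = 0 := by
        intro l
        induction l with
        | nil => rfl
        | cons x l ih => simp [coboundary, ih]
      simp [coboundary, cup, h]
  | cons s ss ih =>
    rw [← funext (coboundary_cupLeft_of_cocycle s ss ih), coboundary_coboundary]

theorem coboundary_cupLeft (s : X → ZMod 2) (ss : List (X → ZMod 2)) :
    coboundary (cupLeft s ss) = cup (s :: ss) :=
  funext (coboundary_cupLeft_of_cocycle s ss (coboundary_cup ss))

theorem exists_ne_of_cup_ne_zero {ss : List (X → ZMod 2)} {l : List X} (h : cup ss l ≠ 0) :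
    l ≠ [] ∧ ∀ s ∈ ss, ∃ x ∈ l, ∃ y ∈ l, s x ≠ s y := by
  induction ss generalizing l with
  | nil =>
    refine ⟨?_, by simp⟩
    rintro rfl
    exact h rfl
  | cons s ss ih =>
    match l, h with
    | x :: y :: l, h =>
      rw [cup] at h
      refine ⟨by simp, fun t ht => ?_⟩
      rcases List.mem_cons.1 ht with rfl | ht
      · refine ⟨x, by simp, y, by simp, fun hxy => left_ne_zero_of_mul h ?_⟩
        rw [hxy, CharTwo.add_self_eq_zero]
      · obtain ⟨a, ha, b, hb, hab⟩ := (ih (right_ne_zero_of_mul h)).2 t ht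
        exact ⟨a, List.mem_cons_of_mem _ ha, b, List.mem_cons_of_mem _ hb, hab⟩

end Cochains

section Sphere

variable {n : ℕ}

/-- Lists of points of mutual distance at most `ε` in the subsphere of dimension `k`. -/
def IsSmall (k : ℕ) (ε : ℝ) (l : List (EuclideanSpace ℝ (Fin (n + 1)))) : Prop :=
  (∀ x ∈ l, ‖x‖ = 1 ∧ ∀ j : Fin (n + 1), k < j → x j = 0) ∧ ∀ x ∈ l, ∀ y ∈ l, dist x y ≤ ε

theorem IsSmall.map_neg {k : ℕ} {ε : ℝ} {l : List (EuclideanSpace ℝ (Fin (n + 1)))}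
    (h : IsSmall k ε l) : IsSmall k ε (l.map Neg.neg) := by
  simpa only [IsSmall, List.forall_mem_map, norm_neg, PiLp.neg_apply, neg_eq_zero, dist_neg_neg]
    using h

/-- A function to `ZMod 2` exchanging the two values of antipodal points of the sphere. -/
def IsOddOnSphere (s : EuclideanSpace ℝ (Fin (n + 1)) → ZMod 2) : Prop :=
  ∀ x, ‖x‖ = 1 → s (-x) = s x + 1

theorem exists_isOddOnSphere : ∃ s : EuclideanSpace ℝ (Fin (n + 1)) → ZMod 2,
    IsOddOnSphere s := by
  classical
  refine ⟨fun x => if WellOrderingRel x (-x) then 1 else 0, fun x hx => ?_⟩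
  have hne : x ≠ -x := by
    intro h
    have h₂ : (2 : ℝ) • x = 0 := by rw [two_smul, ← eq_neg_iff_add_eq_zero, ← h]
    rw [(smul_eq_zero.1 h₂).resolve_left two_ne_zero, norm_zero] at hx
    exact zero_ne_one hx
  have htri := trichotomous_of WellOrderingRel x (-x)
  have hasymm : WellOrderingRel x (-x) → ¬ WellOrderingRel (-x) x := fun h h' =>
    asymm_of WellOrderingRel h h'
  simp only [neg_neg]
  by_cases h : WellOrderingRel x (-x)
  · rw [if_neg (hasymm h), if_pos h]
    decide
  · have h' : WellOrderingRel (-x) x := by tauto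
    rw [if_pos h', if_neg h, zero_add]

theorem cup_map_neg {k : ℕ} {ε : ℝ} {ss : List (EuclideanSpace ℝ (Fin (n + 1)) → ZMod 2)}
    (hss : ∀ s ∈ ss, IsOddOnSphere s) {l : List (EuclideanSpace ℝ (Fin (n + 1)))}
    (hl : IsSmall k ε l) : cup ss (l.map Neg.neg) = cup ss l := by
  replace hl : ∀ x ∈ l, ‖x‖ = 1 := fun x hx => (hl.1 x hx).1
  induction ss generalizing l with
  | nil =>
    match l with
    | [] => rfl
    | [x] => rfl
    | x :: y :: l => rfl
  | cons s ss ih =>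
    match l, hl with
    | [], _ => rfl
    | [x], _ => rfl
    | x :: y :: l, hl =>
      have h := ih (l := y :: l) (fun t ht => hss t (by simp [ht]))
        fun z hz => hl z (List.mem_cons_of_mem _ hz)
      have hs := hss s (by simp)
      simp only [List.map_cons, cup] at h ⊢
      rw [h, hs x (hl x (by simp)), hs y (hl y (by simp))]
      linear_combination cup ss (y :: l) * CharTwo.add_self_eq_zero (1 : ZMod 2)

theorem cupLeft_add_map_neg {k : ℕ} {ε : ℝ} {s : EuclideanSpace ℝ (Fin (n + 1)) → ZMod 2}
    {ss : List (EuclideanSpace ℝ (Fin (n + 1)) → ZMod 2)} (hs : IsOddOnSphere s)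
    (hss : ∀ s ∈ ss, IsOddOnSphere s) {l : List (EuclideanSpace ℝ (Fin (n + 1)))}
    (hl : IsSmall k ε l) : cupLeft s ss l + cupLeft s ss (l.map Neg.neg) = cup ss l := by
  have h := cup_map_neg hss hl
  match l, hl, h with
  | [], _, _ => cases ss <;> simp [cupLeft, cup]
  | x :: l, hl, h =>
    simp only [List.map_cons, cupLeft] at h ⊢
    rw [h, hs x (hl.1 x (by simp)).1]
    linear_combination CharTwo.add_self_eq_zero (s x * cup ss (x :: l))

/-- The pullback of cochains along the antipodal map. -/
def negHom : (List (EuclideanSpace ℝ (Fin (n + 1))) → ZMod 2) →+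
    (List (EuclideanSpace ℝ (Fin (n + 1))) → ZMod 2) where
  toFun φ l := φ (l.map Neg.neg)
  map_zero' := rfl
  map_add' _ _ := rfl

theorem negHom_negHom (φ : List (EuclideanSpace ℝ (Fin (n + 1))) → ZMod 2) :
    negHom (negHom φ) = φ := by
  funext l
  simp [negHom]

theorem negHom_coboundary (φ : List (EuclideanSpace ℝ (Fin (n + 1))) → ZMod 2) :
    negHom (coboundary φ) = coboundary (negHom φ) := by
  funext l
  exact (coboundary_comp_map Neg.neg φ l).symm

/-- The point at angle `θ` on the great circle through `x` and `e`. -/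
noncomputable def rotate (e : EuclideanSpace ℝ (Fin (n + 1))) (θ : ℝ)
    (x : EuclideanSpace ℝ (Fin (n + 1))) : EuclideanSpace ℝ (Fin (n + 1)) :=
  Real.cos θ • x + Real.sin θ • e

theorem norm_rotate {e x : EuclideanSpace ℝ (Fin (n + 1))} (he : ‖e‖ = 1) (hx : ‖x‖ = 1)
    (hxe : inner ℝ x e = 0) (θ : ℝ) : ‖rotate e θ x‖ = 1 := by
  have h : ‖rotate e θ x‖ ^ 2 = 1 := by
    rw [rotate, norm_add_sq_real, norm_smul, norm_smul, inner_smul_left, inner_smul_right, hxe,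
      he, hx]
    simp
  exact (pow_eq_one_iff_of_nonneg (norm_nonneg _) two_ne_zero).1 h

theorem dist_rotate_le {e x y : EuclideanSpace ℝ (Fin (n + 1))} (he : ‖e‖ = 1) (hx : ‖x‖ = 1)
    (θ η : ℝ) : dist (rotate e θ x) (rotate e η y) ≤ dist x y + 2 * |θ - η| := by
  have h : rotate e θ x - rotate e η y =
      (Real.cos θ - Real.cos η) • x + Real.cos η • (x - y) + (Real.sin θ - Real.sin η) • e := by
    simp only [rotate]
    module
  rw [dist_eq_norm, h, dist_eq_norm]
  refine (norm_add₃_le).trans ?_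
  rw [norm_smul, norm_smul, norm_smul, he, hx]
  simp only [Real.norm_eq_abs, mul_one]
  have h₁ := Real.abs_cos_sub_cos_le θ η
  have h₂ := Real.abs_sin_sub_sin_le θ η
  have h₃ := mul_le_of_le_one_left (norm_nonneg (x - y)) (Real.abs_cos_le_one η)
  linarith

/-- The value of a hemisphere chain `c` and its antipode on a cochain. -/
abbrev closeUp (c : (List (EuclideanSpace ℝ (Fin (n + 1))) → ZMod 2) →+ ZMod 2) :
    (List (EuclideanSpace ℝ (Fin (n + 1))) → ZMod 2) →+ ZMod 2 :=
  c + c.comp negHom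

/-- Small simplices in the `k`-sphere carry a chain, given by its values on cochains, which together
with its antipode forms a cycle detecting all products of `k` coboundaries of odd functions. -/
theorem exists_hemisphere_chain (k : ℕ) (hk : k ≤ n) (ε : ℝ) (hε : 0 < ε) :
    ∃ c : (List (EuclideanSpace ℝ (Fin (n + 1))) → ZMod 2) →+ ZMod 2,
      (∀ φ, (∀ l, IsSmall k ε l → φ l = 0) → c φ = 0) ∧
      (∀ φ, closeUp c (coboundary φ) = 0) ∧
      ∀ s ss, IsOddOnSphere s → (∀ t ∈ ss, IsOddOnSphere t) → ss.length = k →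
        closeUp c (cupLeft s ss) = 1 := by
  induction k generalizing ε with
  | zero =>
    let v : EuclideanSpace ℝ (Fin (n + 1)) := EuclideanSpace.single 0 1
    have hv : ‖v‖ = 1 := by simp [v]
    refine ⟨Pi.evalAddMonoidHom _ [v], fun φ hφ => hφ _ ⟨?_, ?_⟩, fun φ => ?_, ?_⟩
    · intro x hx
      rw [List.mem_singleton.1 hx]
      refine ⟨hv, fun j hj => ?_⟩
      have : j ≠ 0 := by
        rintro rfl
        simp at hj
      simp [v, this]
    · intro x hx y hy
      rw [List.mem_singleton.1 hx, List.mem_singleton.1 hy, dist_self]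
      exact hε.le
    · simp [negHom, coboundary, CharTwo.add_self_eq_zero]
    · intro s ss hs _ hlen
      rw [List.eq_nil_of_length_eq_zero hlen]
      simp only [AddMonoidHom.add_apply, AddMonoidHom.comp_apply, Pi.evalAddMonoidHom_apply,
        negHom, AddMonoidHom.coe_mk, ZeroHom.coe_mk, List.map_cons, List.map_nil, cupLeft, cup,
        hs v hv]
      linear_combination CharTwo.add_self_eq_zero (s v)
  | succ k ih =>
    obtain ⟨c, hc, hcd, hcs⟩ := ih (by omega) (ε / 2) (by positivity)
    obtain ⟨M, hM⟩ := exists_nat_gt (Real.pi / (ε / 2))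
    have hM0 : (0 : ℝ) < M := lt_trans (by positivity) hM
    let e : EuclideanSpace ℝ (Fin (n + 1)) := EuclideanSpace.single ⟨k + 1, by omega⟩ 1
    have he : ‖e‖ = 1 := by simp [e]
    let f : ℕ → EuclideanSpace ℝ (Fin (n + 1)) → EuclideanSpace ℝ (Fin (n + 1)) :=
      fun j => rotate e (j * (Real.pi / 2 / M))
    have hstep : 2 * (Real.pi / 2 / M) ≤ ε / 2 := by
      rw [div_lt_iff₀ (by positivity)] at hM
      rw [← mul_div_assoc, div_le_iff₀ hM0]
      linarith
    have hz : ∀ φ, (∀ l, IsSmall k (ε / 2) l → φ l = 0) → closeUp c φ = 0 := by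
      intro φ hφ
      rw [AddMonoidHom.add_apply, hc φ hφ, zero_add]
      exact hc _ fun l hl => hφ _ hl.map_neg
    have hprism : ∀ φ, (∀ l, IsSmall (k + 1) ε l → φ l = 0) → ∀ j,
        closeUp c (prismHom (f j) (f (j + 1)) φ) = 0 := by
      intro φ hφ j
      refine hz _ fun l hl => prism_eq_zero _ _ _ _ fun m hm => hφ m ?_
      have hm' : ∀ y ∈ m, ∃ x ∈ l, ∃ i : ℕ, (i = j ∨ i = j + 1) ∧ y = f i x := by
        intro y hy
        obtain ⟨x, hx, rfl | rfl⟩ := hm y hy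
        exacts [⟨x, hx, j, by simp, rfl⟩, ⟨x, hx, j + 1, by simp, rfl⟩]
      refine ⟨fun y hy => ?_, fun y hy y' hy' => ?_⟩
      · obtain ⟨x, hx, i, -, rfl⟩ := hm' y hy
        obtain ⟨hx₁, hx₂⟩ := hl.1 x hx
        refine ⟨norm_rotate he hx₁ ?_ _, fun p hp => ?_⟩
        · simp [e, EuclideanSpace.inner_single_right, hx₂]
        · have hpe : p ≠ ⟨k + 1, by omega⟩ := by
            intro h
            simp [h] at hp
          simp [f, rotate, e, hx₂ p (by omega), hpe]
      · obtain ⟨x, hx, i, hi, rfl⟩ := hm' y hy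
        obtain ⟨x', hx', i', hi', rfl⟩ := hm' y' hy'
        have hii : |(i : ℝ) - i'| ≤ 1 := by
          rcases hi with rfl | rfl <;> rcases hi' with rfl | rfl <;> simp
        refine (dist_rotate_le he (hl.1 x hx).1 _ _).trans ?_
        rw [← sub_mul, abs_mul, abs_of_pos (show 0 < Real.pi / 2 / M by positivity)]
        have := hl.2 x hx x' hx'
        have := mul_le_mul_of_nonneg_right hii (show 0 ≤ Real.pi / 2 / M by positivity)
        linarith
    let c' : (List (EuclideanSpace ℝ (Fin (n + 1))) → ZMod 2) →+ ZMod 2 :=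
      ∑ j ∈ Finset.range M, (closeUp c).comp (prismHom (f j) (f (j + 1)))
    have hc' : ∀ φ, c' φ = ∑ j ∈ Finset.range M, closeUp c (prismHom (f j) (f (j + 1)) φ) := by
      intro φ
      simp only [c', AddMonoidHom.finsetSum_apply, AddMonoidHom.comp_apply]
    have hf0 : f 0 = id := by
      funext x
      simp [f, rotate]
    have hfM : f M = fun _ => e := by
      funext x
      simp [f, rotate, mul_div_cancel₀ _ hM0.ne']
    have hbd : ∀ φ, c' (coboundary φ) = closeUp c φ := by
      intro φ
      have hj : ∀ j, closeUp c (prismHom (f j) (f (j + 1)) (coboundary φ)) =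
          closeUp c (fun l => φ (l.map (f (j + 1)))) - closeUp c (fun l => φ (l.map (f j))) := by
        intro j
        have h : prismHom (f j) (f (j + 1)) (coboundary φ) +
            coboundary (prismHom (f j) (f (j + 1)) φ) =
            (fun l => φ (l.map (f (j + 1)))) + fun l => φ (l.map (f j)) :=
          funext (prism_coboundary _ _ φ)
        have h' := congrArg (closeUp c) h
        rw [map_add, map_add, hcd, add_zero] at h'
        rw [h', CharTwo.sub_eq_add]
      rw [hc', Finset.sum_congr rfl fun j _ => hj j,
        Finset.sum_range_sub (fun j => closeUp c fun l => φ (l.map (f j))), hf0, hfM]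
      have hconst : closeUp c (fun l => φ (l.map fun _ => e)) = 0 := by
        have : negHom (fun l => φ (l.map fun _ => e)) =
            fun l : List (EuclideanSpace ℝ (Fin (n + 1))) => φ (l.map fun _ => e) := by
          funext l
          simp [negHom]
        rw [AddMonoidHom.add_apply, AddMonoidHom.comp_apply, this, CharTwo.add_self_eq_zero]
      rw [hconst, CharTwo.sub_eq_add, zero_add]
      simp
    have hsupp : ∀ φ, (∀ l, IsSmall (k + 1) ε l → φ l = 0) → c' φ = 0 := by
      intro φ hφ
      rw [hc']
      exact Finset.sum_eq_zero fun j _ => hprism φ hφ j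
    refine ⟨c', hsupp, fun φ => ?_, ?_⟩
    · rw [AddMonoidHom.add_apply, AddMonoidHom.comp_apply, negHom_coboundary, hbd, hbd]
      simp only [AddMonoidHom.add_apply, AddMonoidHom.comp_apply, negHom_negHom]
      linear_combination CharTwo.add_self_eq_zero (c φ) + CharTwo.add_self_eq_zero (c (negHom φ))
    · intro s ss hs hss hlen
      match ss, hlen with
      | t :: ss, hlen =>
        have h : closeUp c' (cupLeft s (t :: ss)) = c' (cup (t :: ss)) := by
          rw [AddMonoidHom.add_apply, AddMonoidHom.comp_apply, ← map_add, ← sub_eq_zero, ← map_sub]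
          refine hsupp _ fun l hl => (sub_eq_zero (G := ZMod 2)).2 ?_
          exact cupLeft_add_map_neg hs hss hl
        rw [h, ← coboundary_cupLeft, hbd]
        exact hcs t ss (hss t (by simp)) (fun r hr => hss r (by simp [hr])) (by simpa using hlen)

/-- Any `n` odd functions from the `n`-sphere to `ZMod 2` have a common point of discontinuity. -/
theorem exists_forall_not_locally_constant (s : Fin n → EuclideanSpace ℝ (Fin (n + 1)) → ZMod 2)
    (hs : ∀ t, IsOddOnSphere (s t)) :
    ∃ u ∈ Metric.sphere (0 : EuclideanSpace ℝ (Fin (n + 1))) 1, ∀ t, ∀ U, IsOpen U → u ∈ U →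
      ∃ x ∈ U ∩ Metric.sphere 0 1, ∃ y ∈ U ∩ Metric.sphere 0 1, s t x ≠ s t y := by
  by_contra! hcon
  choose t U hU hmem hconst using hcon
  obtain ⟨δ, hδ, hball⟩ := lebesgue_number_lemma_of_metric
    (isCompact_sphere (0 : EuclideanSpace ℝ (Fin (n + 1))) 1)
    (c := fun u : Metric.sphere (0 : EuclideanSpace ℝ (Fin (n + 1))) 1 => U u u.2)
    (fun u => hU u u.2) fun u hu => Set.mem_iUnion.2 ⟨⟨u, hu⟩, hmem u hu⟩
  obtain ⟨c, hc, -, hcs⟩ := exists_hemisphere_chain (n := n) n le_rfl (δ / 2) (by positivity)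
  obtain ⟨s₀, hs₀⟩ := exists_isOddOnSphere (n := n)
  have hss : ∀ r ∈ List.ofFn s, IsOddOnSphere r := by
    intro r hr
    obtain ⟨i, rfl⟩ := (List.mem_ofFn' s r).1 hr
    exact hs i
  have hone := hcs s₀ (List.ofFn s) hs₀ hss (by simp)
  obtain ⟨l, hl, hne⟩ : ∃ l, IsSmall n (δ / 2) l ∧ cup (List.ofFn s) l ≠ 0 := by
    by_contra! h
    rw [AddMonoidHom.add_apply, AddMonoidHom.comp_apply, ← map_add, hc] at hone
    · exact zero_ne_one hone
    · exact fun l hl => (cupLeft_add_map_neg hs₀ hss hl).trans (h l hl)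
  obtain ⟨hnil, hl'⟩ := exists_ne_of_cup_ne_zero hne
  obtain ⟨a, ha⟩ := List.exists_mem_of_ne_nil l hnil
  have hsph : ∀ x ∈ l, x ∈ Metric.sphere (0 : EuclideanSpace ℝ (Fin (n + 1))) 1 := fun x hx => by
    simpa using (hl.1 x hx).1
  obtain ⟨u, hu⟩ := hball a (hsph a ha)
  have hsub : ∀ x ∈ l, x ∈ U u u.2 ∩ Metric.sphere 0 1 := fun x hx =>
    ⟨hu (Metric.mem_ball.2 ((hl.2 x hx a ha).trans_lt (by linarith))), hsph x hx⟩
  obtain ⟨x, hx, y, hy, hxy⟩ := hl' (s (t u u.2)) ((List.mem_ofFn' s _).2 ⟨t u u.2, rfl⟩)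
  exact hxy (hconst u u.2 x (hsub x hx) y (hsub y hy))

end Sphere

section Patterns

variable {E ι : Type*} [NormedAddCommGroup E]

/-- There is an alternating pattern of length `k + 1` witnessed by `u`, starting at the index `i`
and increasing with respect to `r`. -/
def StartsPattern (r : ι → ι → Prop) (F : ι → Set E) : ℕ → ι → E → Prop
  | 0, i, u => u ∈ F i
  | k + 1, i, u => u ∈ F i ∧ ∃ j, r i j ∧ StartsPattern r F k j (-u)

theorem StartsPattern.mem {r : ι → ι → Prop} {F : ι → Set E} {k : ℕ} {i : ι} {u : E}
    (h : StartsPattern r F k i u) : u ∈ F i := by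
  cases k with
  | zero => exact h
  | succ k => exact h.1

theorem StartsPattern.mono {r : ι → ι → Prop} {F : ι → Set E} {k : ℕ} {i : ι} {u w : E}
    (hwu : ∀ i, (w ∈ F i → u ∈ F i) ∧ (-w ∈ F i → -u ∈ F i)) (h : StartsPattern r F k i w) :
    StartsPattern r F k i u := by
  induction k generalizing i u w with
  | zero => exact (hwu i).1 h
  | succ k ih =>
    obtain ⟨hw, j, hij, hj⟩ := h
    refine ⟨(hwu i).1 hw, j, hij, ih (fun p => ?_) hj⟩
    rw [neg_neg, neg_neg]
    exact (hwu p).symm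

theorem StartsPattern.exists_fin [NormedSpace ℝ E] {r : ι → ι → Prop} [IsTrans ι r]
    {F : ι → Set E} {k : ℕ} {i : ι} {u : E} (h : StartsPattern r F k i u) :
    ∃ g : Fin (k + 1) → ι, g 0 = i ∧
      (∀ a b, a < b → r (g a) (g b)) ∧ ∀ a : Fin (k + 1), (-1 : ℝ) ^ (a : ℕ) • u ∈ F (g a) := by
  induction k generalizing i u with
  | zero => exact ⟨fun _ => i, rfl, fun a b hab => by omega, fun a => by simpa using h.mem⟩
  | succ k ih =>
    obtain ⟨hu, j, hij, hj⟩ := h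
    obtain ⟨g, hg₀, hg, hgF⟩ := ih hj
    refine ⟨Fin.cons i g, rfl, fun a b hab => ?_, fun a => ?_⟩
    · induction b using Fin.cases with
      | zero => exact absurd hab (Fin.not_lt_zero a)
      | succ b =>
        induction a using Fin.cases with
        | zero =>
          rw [Fin.cons_zero, Fin.cons_succ]
          rcases eq_or_ne b 0 with rfl | hb
          · rwa [hg₀]
          · exact _root_.trans (hg₀ ▸ hij) (hg 0 b (Fin.pos_of_ne_zero hb))
        | succ a =>
          simp only [Fin.cons_succ]
          exact hg a b (Fin.succ_lt_succ_iff.1 hab)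
    · induction a using Fin.cases with
      | zero => simpa using hu
      | succ a =>
        rw [Fin.cons_succ, Fin.val_succ, pow_succ, mul_neg_one, neg_smul, ← smul_neg]
        exact hgF a

theorem le_maxAltPattern [NormedSpace ℝ E] [Finite ι] {lt₁ lt₂ : ι → ι → Prop}
    [IsTrans ι lt₁] [Std.Irrefl lt₁] [IsTrans ι lt₂] {F : ι → Set E} {k : ℕ} {i : ι} {u : E} {ε : ℝ}
    (hε : ε = 1 ∨ ε = -1) (h : StartsPattern (fun a b => lt₁ a b ∧ lt₂ a b) F k i (ε • u)) :
    k + 1 ≤ maxAltPattern lt₁ lt₂ F u := by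
  have : IsTrans ι fun a b => lt₁ a b ∧ lt₂ a b :=
    ⟨fun _ _ _ hab hbc => ⟨_root_.trans hab.1 hbc.1, _root_.trans hab.2 hbc.2⟩⟩
  have : Fintype ι := Fintype.ofFinite ι
  refine le_csSup ⟨Fintype.card ι, ?_⟩ ?_
  · rintro m ⟨_, _, g, hg, _⟩
    have hinj : Function.Injective g := fun a b hab => by
      by_contra hne
      rcases lt_or_gt_of_ne hne with hlt | hlt <;>
        exact irrefl_of lt₁ (g b) (hab ▸ (hg _ _ hlt).1)
    simpa using Fintype.card_le_of_injective g hinj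
  · obtain ⟨g, -, hg, hgF⟩ := h.exists_fin
    refine ⟨ε, hε, g, hg, fun a => ?_⟩
    rw [mul_comm, mul_smul]
    exact hgF a

/-- Some index starts both an `r₁`-pattern of length `p.1 + 1` and an `r₂`-pattern of length
`p.2 + 1` witnessed by `u`. -/
def StartsBoth (r₁ r₂ : ι → ι → Prop) (F : ι → Set E) (u : E) (p : ℕ × ℕ) : Prop :=
  ∃ i, StartsPattern r₁ F p.1 i u ∧ StartsPattern r₂ F p.2 i u

theorem StartsBoth.mono {r₁ r₂ : ι → ι → Prop} {F : ι → Set E} {u w : E} {p : ℕ × ℕ}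
    (hwu : ∀ i, (w ∈ F i → u ∈ F i) ∧ (-w ∈ F i → -u ∈ F i)) (h : StartsBoth r₁ r₂ F w p) :
    StartsBoth r₁ r₂ F u p :=
  let ⟨i, h₁, h₂⟩ := h
  ⟨i, h₁.mono hwu, h₂.mono hwu⟩

/-- The pairs of lengths realized at `u` or `-u` in the sense of `StartsBoth`. -/
def lengthPairs (r₁ r₂ : ι → ι → Prop) (F : ι → Set E) (u : E) : Set (ℕ × ℕ) :=
  {p | StartsBoth r₁ r₂ F u p ∨ StartsBoth r₁ r₂ F (-u) p}

theorem lengthPairs_neg (r₁ r₂ : ι → ι → Prop) (F : ι → Set E) (u : E) :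
    lengthPairs r₁ r₂ F (-u) = lengthPairs r₁ r₂ F u := by
  ext p
  simp [lengthPairs, or_comm]

theorem lengthPairs_mono {r₁ r₂ : ι → ι → Prop} {F : ι → Set E} {u w : E}
    (hwu : ∀ i, (w ∈ F i → u ∈ F i) ∧ (-w ∈ F i → -u ∈ F i)) :
    lengthPairs r₁ r₂ F w ⊆ lengthPairs r₁ r₂ F u := by
  rintro p (h | h)
  · exact Or.inl (h.mono hwu)
  · exact Or.inr (h.mono fun i => by simpa using (hwu i).symm)

/-- A pair of lengths that cannot be increased is realized by only one of `u` and `-u`. -/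
theorem not_startsBoth_neg {r₁ r₂ : ι → ι → Prop}
    (htri : ∀ i j, i ≠ j → (r₁ i j ∨ r₂ i j) ∨ (r₁ j i ∨ r₂ j i)) {F : ι → Set E}
    (hanti : ∀ i, F i ∩ (-F i) = ∅) {u : E} {p : ℕ × ℕ}
    (hp : ∀ q ∈ lengthPairs r₁ r₂ F u, q.1 + q.2 ≤ p.1 + p.2) (h : StartsBoth r₁ r₂ F u p) :
    ¬ StartsBoth r₁ r₂ F (-u) p := by
  have key : ∀ (v : E) (i j : ι), (∀ q, StartsBoth r₁ r₂ F v q → q.1 + q.2 ≤ p.1 + p.2) →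
      StartsPattern r₁ F p.1 i v → StartsPattern r₂ F p.2 i v → StartsPattern r₁ F p.1 j (-v) →
      StartsPattern r₂ F p.2 j (-v) → ¬ (r₁ i j ∨ r₂ i j) := by
    rintro v i j hv hi₁ hi₂ hj₁ hj₂ (hij | hij)
    · have := hv (p.1 + 1, p.2) ⟨i, ⟨hi₁.mem, j, hij, hj₁⟩, hi₂⟩
      simp only at this
      omega
    · have := hv (p.1, p.2 + 1) ⟨i, hi₁, hi₂.mem, j, hij, hj₂⟩
      simp only at this
      omega
  rintro ⟨j, hj₁, hj₂⟩
  obtain ⟨i, hi₁, hi₂⟩ := h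
  have hij : i ≠ j := by
    rintro rfl
    exact (hanti i).le ⟨hi₁.mem, hj₁.mem⟩
  rcases htri i j hij with h | h
  · exact key u i j (fun q hq => hp q (Or.inl hq)) hi₁ hi₂ hj₁ hj₂ h
  · exact key (-u) j i (fun q hq => hp q (Or.inr hq)) hj₁ hj₂ (by rwa [neg_neg])
      (by rwa [neg_neg]) h

theorem lengthPairs_subset [NormedSpace ℝ E] [Finite ι] {lt₁ lt₂ : ι → ι → Prop}
    [IsTrans ι lt₁] [Std.Irrefl lt₁] [IsTrans ι lt₂] (F : ι → Set E) (u : E) :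
    lengthPairs (fun a b => lt₁ a b ∧ lt₂ a b) (fun a b => lt₁ a b ∧ lt₂ b a) F u ⊆
      (Finset.range (maxAltPattern lt₁ lt₂ F u) ×ˢ
        Finset.range (maxAltPattern lt₁ (fun a b => lt₂ b a) F u) : Finset (ℕ × ℕ)) := by
  have : IsTrans ι fun a b => lt₂ b a := ⟨fun _ _ _ hab hbc => _root_.trans hbc hab⟩
  have key : ∀ ε : ℝ, (ε = 1 ∨ ε = -1) → ∀ p, StartsBoth (fun a b => lt₁ a b ∧ lt₂ a b)
      (fun a b => lt₁ a b ∧ lt₂ b a) F (ε • u) p →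
      p.1 < maxAltPattern lt₁ lt₂ F u ∧ p.2 < maxAltPattern lt₁ (fun a b => lt₂ b a) F u :=
    fun ε hε p ⟨i, h₁, h₂⟩ => ⟨le_maxAltPattern hε h₁, le_maxAltPattern hε h₂⟩
  intro p hp
  simp only [Finset.coe_product, Finset.coe_range, Set.mem_prod, Set.mem_Iio]
  rcases hp with h | h
  · exact key 1 (Or.inl rfl) p (by rwa [one_smul])
  · exact key (-1) (Or.inr rfl) p (by rwa [neg_one_smul])

theorem eventually_mem_imp_mem [Finite ι] {F : ι → Set E} (hclosed : ∀ i, IsClosed (F i)) (u : E) :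
    ∀ᶠ w in nhds u, ∀ i, (w ∈ F i → u ∈ F i) ∧ (-w ∈ F i → -u ∈ F i) := by
  have key : ∀ C : Set E, IsClosed C → ∀ v, ∀ᶠ w in nhds v, w ∈ C → v ∈ C := by
    intro C hC v
    by_cases hv : v ∈ C
    · exact Filter.Eventually.of_forall fun _ _ => hv
    · filter_upwards [hC.isOpen_compl.mem_nhds hv] with w hw hw'
      exact absurd hw' hw
  refine Filter.eventually_all.2 fun i => (key _ (hclosed i) u).and ?_
  exact (continuous_neg.tendsto u).eventually (key _ (hclosed i) (-u))

theorem exists_maximal_sum {D : Set (ℕ × ℕ)} (hfin : D.Finite) (hne : D.Nonempty) :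
    ∃ p ∈ D, ∀ q ∈ D, q.1 + q.2 ≤ p.1 + p.2 :=
  hfin.exists_maximalFor (fun p => p.1 + p.2) D hne |>.imp fun p hp =>
    ⟨hp.1, fun q hq => (le_total (q.1 + q.2) (p.1 + p.2)).elim id fun h => hp.2 hq h⟩

end Patterns

/-- A set of points of the sphere whose antipode is locally separated from it can be separated from
its antipode by an odd function which is locally constant along it. -/
theorem exists_odd_locally_constant {n : ℕ} (A : Set (EuclideanSpace ℝ (Fin (n + 1))))
    (hA : ∀ u ∈ A, ∀ᶠ w in nhds u, -w ∉ A) :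
    ∃ s : EuclideanSpace ℝ (Fin (n + 1)) → ZMod 2, IsOddOnSphere s ∧
      ∀ u, u ∈ A ∨ -u ∈ A → ∃ U, IsOpen U ∧ u ∈ U ∧ ∀ x ∈ U ∩ Metric.sphere 0 1,
        ∀ y ∈ U ∩ Metric.sphere 0 1, s x = s y := by
  classical
  obtain ⟨s₀, hs₀⟩ := exists_isOddOnSphere (n := n)
  let V : Set (EuclideanSpace ℝ (Fin (n + 1))) :=
    {x | Metric.infEDist x A < Metric.infEDist (-x) A}
  have hcont : Continuous fun x : EuclideanSpace ℝ (Fin (n + 1)) => Metric.infEDist x A :=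
    Metric.continuous_infEDist
  have hV : IsOpen V := isOpen_lt hcont (hcont.comp continuous_neg)
  have hVneg : ∀ x ∈ V, -x ∉ V := by
    intro x hx hx'
    simp only [V, Set.mem_ofPred_eq, neg_neg] at hx hx'
    exact lt_asymm hx hx'
  have hAV : A ⊆ V := by
    intro u hu
    simp only [V, Set.mem_ofPred_eq]
    rw [Metric.infEDist_zero_of_mem hu, pos_iff_ne_zero]
    intro h
    have hcl : -u ∈ closure A := Metric.mem_closure_iff_infEDist_zero.2 h
    have hev : ∀ᶠ w in nhds (-u), w ∉ A := by
      have := (continuous_neg.tendsto (-u)).eventually (by rw [neg_neg]; exact hA u hu)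
      simpa using this
    exact mem_closure_iff_frequently.1 hcl hev
  let s : EuclideanSpace ℝ (Fin (n + 1)) → ZMod 2 := fun x =>
    if x ∈ V then 1 else if -x ∈ V then 0 else s₀ x
  have hs₁ : ∀ x ∈ V, s x = 1 := fun x hx => if_pos hx
  have hs₂ : ∀ x, -x ∈ V → s x = 0 := fun x hx => by
    have hx' : x ∉ V := fun h => hVneg x h hx
    simp [s, hx, hx']
  refine ⟨s, fun x hx => ?_, fun u hu => ?_⟩
  · by_cases h₁ : x ∈ V
    · rw [hs₁ x h₁, hs₂ (-x) (by rwa [neg_neg])]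
      decide
    · by_cases h₂ : -x ∈ V
      · rw [hs₁ _ h₂, hs₂ x h₂, zero_add]
      · simp [s, h₁, h₂, hs₀ x hx]
  · rcases hu with hu | hu
    · exact ⟨V, hV, hAV hu, fun x hx y hy => by rw [hs₁ x hx.1, hs₁ y hy.1]⟩
    · exact ⟨{x | -x ∈ V}, hV.preimage continuous_neg, hAV hu, fun x hx y hy => by
        rw [hs₂ x hx.1, hs₂ y hy.1]⟩

end KyFan

open KyFan

/-- Ky Fan's covering lemma for two orders, product form: there is `u ∈ S^n`
with `h₊₊ · h₊₋ ≥ (n+1)/2`, where `h₊₊` (resp. `h₊₋`) is the maximal length of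
an alternating pattern witnessed by `u` or `-u` increasing in both orders
(resp. increasing in the first and decreasing in the second). -/
theorem kyFan_two_orders_product {n : ℕ} {ι : Type*} [Fintype ι]
    (lt₁ lt₂ : ι → ι → Prop)
    (h₁ : IsStrictTotalOrder ι lt₁) (h₂ : IsStrictTotalOrder ι lt₂)
    (F : ι → Set (EuclideanSpace ℝ (Fin (n + 1))))
    (hclosed : ∀ i, IsClosed (F i))
    (hsub : ∀ i, F i ⊆ Metric.sphere (0 : EuclideanSpace ℝ (Fin (n + 1))) 1)
    (hcover : Metric.sphere (0 : EuclideanSpace ℝ (Fin (n + 1))) 1 ⊆ ⋃ i, F i)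
    (hanti : ∀ i, F i ∩ (-F i) = ∅) :
    ∃ u ∈ Metric.sphere (0 : EuclideanSpace ℝ (Fin (n + 1))) 1,
      ((n : ℝ) + 1) / 2 ≤
        (maxAltPattern lt₁ lt₂ F u : ℝ) *
          (maxAltPattern lt₁ (fun a b => lt₂ b a) F u : ℝ) := by
  classical
  let r₁ : ι → ι → Prop := fun a b => lt₁ a b ∧ lt₂ a b
  let r₂ : ι → ι → Prop := fun a b => lt₁ a b ∧ lt₂ b a
  have htri : ∀ i j, i ≠ j → (r₁ i j ∨ r₂ i j) ∨ (r₁ j i ∨ r₂ j i) := by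
    intro i j hij
    have h₁' := trichotomous_of lt₁ i j
    have h₂' := trichotomous_of lt₂ i j
    simp only [r₁, r₂]
    tauto
  let D := lengthPairs r₁ r₂ F
  have hDsub := lengthPairs_subset (lt₁ := lt₁) (lt₂ := lt₂) F
  have hfin : ∀ u, (D u).Finite := fun u => (Finset.finite_toSet _).subset (hDsub u)
  have hne : ∀ u ∈ Metric.sphere (0 : EuclideanSpace ℝ (Fin (n + 1))) 1, (D u).Nonempty := by
    intro u hu
    obtain ⟨i, hi⟩ := Set.mem_iUnion.1 (hcover hu)
    exact ⟨(0, 0), Or.inl ⟨i, hi, hi⟩⟩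
  have hmax : ∀ C : Set (ℕ × ℕ), ∃ p, C.Finite → C.Nonempty →
      p ∈ C ∧ ∀ q ∈ C, q.1 + q.2 ≤ p.1 + p.2 := by
    intro C
    by_cases hC : C.Finite ∧ C.Nonempty
    · obtain ⟨p, hp⟩ := exists_maximal_sum hC.1 hC.2
      exact ⟨p, fun _ _ => hp⟩
    · exact ⟨0, fun h h' => absurd ⟨h, h'⟩ hC⟩
  choose top htop using hmax
  let A : Fin n → Set (EuclideanSpace ℝ (Fin (n + 1))) := fun t =>
    {w | w ∈ Metric.sphere 0 1 ∧ (D w).ncard = t + 1 ∧ StartsBoth r₁ r₂ F w (top (D w))}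
  have hA : ∀ t, ∀ u ∈ A t, ∀ᶠ w in nhds u, -w ∉ A t := by
    rintro t u ⟨hu, hcard, hstart⟩
    filter_upwards [eventually_mem_imp_mem hclosed u] with w hw
    rintro ⟨-, hcard', hstart'⟩
    have hD : D (-w) = D w := lengthPairs_neg r₁ r₂ F w
    rw [hD] at hcard' hstart'
    have heq : D w = D u :=
      Set.eq_of_subset_of_ncard_le (lengthPairs_mono hw) (by rw [hcard, hcard']) (hfin u)
    rw [heq] at hstart'
    refine not_startsBoth_neg htri hanti (htop _ (hfin u) (hne u hu)).2 hstart ?_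
    exact hstart'.mono fun i => by simpa using (hw i).symm
  choose s hodd hs using fun t => exists_odd_locally_constant (A t) (hA t)
  obtain ⟨u, hu, hdisc⟩ := exists_forall_not_locally_constant s hodd
  have hlarge : n + 1 ≤ (D u).ncard := by
    by_contra! hlt
    have hpos : 0 < (D u).ncard := (Set.ncard_pos (hfin u)).2 (hne u hu)
    let t : Fin n := ⟨(D u).ncard - 1, by omega⟩
    have ht : (D u).ncard = t + 1 := by simp only [t]; omega
    have hmem : u ∈ A t ∨ -u ∈ A t := by
      refine (htop _ (hfin u) (hne u hu)).1.imp (fun h => ⟨hu, ht, h⟩) fun h => ?_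
      have hD : D (-u) = D u := lengthPairs_neg r₁ r₂ F u
      refine ⟨by simpa using hu, ?_, ?_⟩
      · rw [hD, ht]
      · rw [hD]
        exact h
    obtain ⟨U, hU, huU, hconst⟩ := hs t u hmem
    obtain ⟨x, hx, y, hy, hxy⟩ := hdisc t U hU huU
    exact hxy (hconst x hx y hy)
  refine ⟨u, hu, ?_⟩
  have hprod : n + 1 ≤ maxAltPattern lt₁ lt₂ F u * maxAltPattern lt₁ (fun a b => lt₂ b a) F u := by
    have h := Set.ncard_le_ncard (hDsub u) (Finset.finite_toSet _)
    rw [Set.ncard_coe_finset, Finset.card_product, Finset.card_range, Finset.card_range] at h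
    exact hlarge.trans h
  have hprod' : (n : ℝ) + 1 ≤
      (maxAltPattern lt₁ lt₂ F u : ℝ) * (maxAltPattern lt₁ (fun a b => lt₂ b a) F u : ℝ) := by
    exact_mod_cast hprod
  linarith [(Nat.cast_nonneg n : (0 : ℝ) ≤ n)]
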